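/- Theorem 1 (pointwise jump behavior of Volterra processes): Let F be a function of smooth variation of index d ∈ (0,1), let X be a semimartingale with X(0) = X(0−) = 0 a.s., and define M(t) = ∫₀ᵗ F(t,r) dX(r). Then P-almost surely, for every s ∈ [0,1], lim_{h↓0} [M(s+h) − M(s)] / F(s+h, s) = Δ_X(s), where Δ_X(s) = X(s) − X(s−) is the jump of X at s. -/

import Mathlib

open MeasureTheory ProbabilityTheory Filter Set intervalIntegral Real

/-- `p01 F t r = ∂F/∂r (t,r)` -/
noncomputable def p01 (F : ℝ → ℝ → ℝ) (t r : ℝ) : ℝ := deriv (fun x => F t x) r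
/-- `p10 F t r = ∂F/∂t (t,r)` -/
noncomputable def p10 (F : ℝ → ℝ → ℝ) (t r : ℝ) : ℝ := deriv (fun x => F x r) t
/-- `p11 F t r = ∂²F/∂t∂r (t,r)` -/
noncomputable def p11 (F : ℝ → ℝ → ℝ) (t r : ℝ) : ℝ := deriv (fun x => p01 F x r) t
/-- `p02 F t r = ∂²F/∂r² (t,r)` -/
noncomputable def p02 (F : ℝ → ℝ → ℝ) (t r : ℝ) : ℝ := deriv (fun x => p01 F t x) r

/-- `lim_{h↓0} sup_{t∈K} |G h t + c| = 0` for every compact `K ⊂ ℝ`. -/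
def UnifDiagLimit (G : ℝ → ℝ → ℝ) (c : ℝ) : Prop :=
  ∀ K : Set ℝ, IsCompact K → ∀ ε > 0, ∃ h₀ > 0, ∀ h : ℝ, 0 < h → h < h₀ →
    ∀ t ∈ K, |G h t + c| < ε

/-- `F ∈ SR²_ρ(0+)` : a function of smooth variation of index `ρ` at the diagonal. -/
def SmoothVar (F : ℝ → ℝ → ℝ) (ρ : ℝ) : Prop :=
  ContinuousOn (fun p : ℝ × ℝ => F p.1 p.2) {p : ℝ × ℝ | p.2 ≤ p.1} ∧
  ContDiffOn ℝ 2 (fun p : ℝ × ℝ => F p.1 p.2) {p : ℝ × ℝ | p.2 < p.1} ∧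
  (∀ t r : ℝ, r < t → 0 < F t r) ∧
  UnifDiagLimit (fun h t => h * p01 F t (t - h) / F t (t - h)) ρ ∧
  UnifDiagLimit (fun h t => h * p10 F (t + h) t / F (t + h) t) (-ρ) ∧
  UnifDiagLimit (fun h t => h ^ 2 * p11 F t (t - h) / F t (t - h)) (ρ * (ρ - 1)) ∧
  UnifDiagLimit (fun h t => h ^ 2 * p02 F t (t - h) / F t (t - h)) (-(ρ * (ρ - 1)))

section Cadlag

variable {x : ℝ → ℝ}

theorem measurable_of_tendsto_nhdsGE
    (hx : ∀ s, Tendsto x (nhdsWithin s (Set.Ici s)) (nhds (x s))) : Measurable x := by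
  refine measurable_of_tendsto_metrizable
    (f := fun (n : ℕ) r => x (((⌊((n : ℝ) + 1) * r⌋ : ℝ) + 1) / ((n : ℝ) + 1))) (fun n => ?_) ?_
  · have h : Measurable fun k : ℤ => x (((k : ℝ) + 1) / ((n : ℝ) + 1)) := measurable_from_top
    exact h.comp (Int.measurable_floor.comp (measurable_const_mul _))
  · refine tendsto_pi_nhds.2 fun r => (hx r).comp (tendsto_nhdsWithin_iff.2 ⟨?_, ?_⟩)
    · have h0 : Tendsto (fun n : ℕ => r + 1 / ((n : ℝ) + 1)) atTop (nhds r) := by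
        simpa using tendsto_const_nhds.add (tendsto_one_div_add_atTop_nhds_zero_nat (𝕜 := ℝ))
      refine tendsto_of_tendsto_of_tendsto_of_le_of_le tendsto_const_nhds h0 (fun n => ?_)
        (fun n => ?_)
      · have hn : (0 : ℝ) < (n : ℝ) + 1 := by positivity
        rw [le_div_iff₀ hn]
        linarith [Int.lt_floor_add_one (((n : ℝ) + 1) * r)]
      · have hn : (0 : ℝ) < (n : ℝ) + 1 := by positivity
        have : r + 1 / ((n : ℝ) + 1) = (((n : ℝ) + 1) * r + 1) / ((n : ℝ) + 1) := by
          field_simp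
        rw [this]
        gcongr
        exact Int.floor_le _
    · refine Eventually.of_forall fun n => ?_
      have hn : (0 : ℝ) < (n : ℝ) + 1 := by positivity
      rw [Set.mem_Ici, le_div_iff₀ hn]
      linarith [Int.lt_floor_add_one (((n : ℝ) + 1) * r)]

theorem exists_abs_le_of_cadlag {xm : ℝ → ℝ}
    (hx : ∀ s, Tendsto x (nhdsWithin s (Set.Ici s)) (nhds (x s)))
    (hxm : ∀ s, Tendsto x (nhdsWithin s (Set.Iio s)) (nhds (xm s))) {K : Set ℝ}
    (hK : IsCompact K) : ∃ C, ∀ r ∈ K, |x r| ≤ C := by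
  refine hK.induction_on (p := fun S => ∃ C, ∀ r ∈ S, |x r| ≤ C) ⟨0, by simp⟩ ?_ ?_ ?_
  · rintro S T hST ⟨C, hC⟩
    exact ⟨C, fun r hr => hC r (hST hr)⟩
  · rintro S T ⟨C, hC⟩ ⟨D, hD⟩
    refine ⟨max C D, fun r hr => ?_⟩
    rcases hr with hr | hr
    · exact (hC r hr).trans (le_max_left _ _)
    · exact (hD r hr).trans (le_max_right _ _)
  · intro s _
    have h1 : ∀ᶠ r in nhdsWithin s (Set.Ici s), |x r| < |x s| + 1 :=
      (hx s).abs.eventually_lt_const (by linarith)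
    have h2 : ∀ᶠ r in nhdsWithin s (Set.Iio s), |x r| < |xm s| + 1 :=
      (hxm s).abs.eventually_lt_const (by linarith)
    have h3 : ∀ᶠ r in nhds s, |x r| ≤ max (|xm s| + 1) (|x s| + 1) := by
      rw [← nhdsLT_sup_nhdsGE, eventually_sup]
      exact ⟨h2.mono fun r hr => hr.le.trans (le_max_left _ _),
        h1.mono fun r hr => hr.le.trans (le_max_right _ _)⟩
    exact ⟨_, mem_nhdsWithin_of_mem_nhds h3, _, fun r hr => hr⟩

end Cadlag

theorem monotoneOn_rpow_neg_mul {g g' : ℝ → ℝ} {c η : ℝ}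
    (hg : ∀ u ∈ Set.Ioo 0 η, HasDerivAt g (g' u) u)
    (h : ∀ u ∈ Set.Ioo 0 η, c * g u ≤ u * g' u) :
    MonotoneOn (fun u => u ^ (-c) * g u) (Set.Ioo 0 η) := by
  have hd : ∀ u ∈ Set.Ioo 0 η, HasDerivAt (fun u => u ^ (-c) * g u)
      (u ^ (-c - 1) * (u * g' u - c * g u)) u := by
    intro u hu
    refine ((Real.hasDerivAt_rpow_const (p := -c) (Or.inl hu.1.ne')).mul
      (hg u hu)).congr_deriv ?_
    have : u ^ (-c) = u ^ (-c - 1) * u := by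
      rw [← Real.rpow_add_one hu.1.ne']; simp
    rw [this]; ring
  refine monotoneOn_of_deriv_nonneg (convex_Ioo _ _)
    (fun u hu => (hd u hu).continuousAt.continuousWithinAt)
    (fun u hu => (hd u (interior_subset hu)).differentiableAt.differentiableWithinAt) ?_
  intro u hu
  have hu' := interior_subset hu
  rw [(hd u hu').deriv]
  exact mul_nonneg (Real.rpow_nonneg hu'.1.le _) (by linarith [h u hu'])

section Partial

variable {G : ℝ → ℝ → ℝ}

theorem isOpen_snd_lt_fst : IsOpen {p : ℝ × ℝ | p.2 < p.1} :=
  isOpen_lt continuous_snd continuous_fst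

theorem hasDerivAt_p01_fderiv {t r : ℝ}
    (hG : DifferentiableAt ℝ (fun p : ℝ × ℝ => G p.1 p.2) (t, r)) :
    HasDerivAt (fun x => G t x) (fderiv ℝ (fun p : ℝ × ℝ => G p.1 p.2) (t, r) (0, 1)) r :=
  hG.hasFDerivAt.comp_hasDerivAt (f := fun x => (t, x)) r
    ((hasDerivAt_const r t).prodMk (hasDerivAt_id r))

theorem hasDerivAt_p10_fderiv {t r : ℝ}
    (hG : DifferentiableAt ℝ (fun p : ℝ × ℝ => G p.1 p.2) (t, r)) :
    HasDerivAt (fun x => G x r) (fderiv ℝ (fun p : ℝ × ℝ => G p.1 p.2) (t, r) (1, 0)) t :=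
  hG.hasFDerivAt.comp_hasDerivAt (f := fun x => (x, r)) t
    ((hasDerivAt_id t).prodMk (hasDerivAt_const t r))

theorem differentiableAt_of_contDiffOn_one
    (hG : ContDiffOn ℝ 1 (fun p : ℝ × ℝ => G p.1 p.2) {p : ℝ × ℝ | p.2 < p.1}) {t r : ℝ}
    (hrt : r < t) : DifferentiableAt ℝ (fun p : ℝ × ℝ => G p.1 p.2) (t, r) :=
  (hG.contDiffAt (isOpen_snd_lt_fst.mem_nhds hrt)).differentiableAt (by norm_num)

theorem hasDerivAt_p01
    (hG : ContDiffOn ℝ 1 (fun p : ℝ × ℝ => G p.1 p.2) {p : ℝ × ℝ | p.2 < p.1}) {t r : ℝ}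
    (hrt : r < t) : HasDerivAt (fun x => G t x) (p01 G t r) r :=
  (hasDerivAt_p01_fderiv
    (differentiableAt_of_contDiffOn_one hG hrt)).differentiableAt.hasDerivAt

theorem hasDerivAt_p10
    (hG : ContDiffOn ℝ 1 (fun p : ℝ × ℝ => G p.1 p.2) {p : ℝ × ℝ | p.2 < p.1}) {t r : ℝ}
    (hrt : r < t) : HasDerivAt (fun x => G x r) (p10 G t r) t :=
  (hasDerivAt_p10_fderiv
    (differentiableAt_of_contDiffOn_one hG hrt)).differentiableAt.hasDerivAt

theorem contDiffOn_p01
    (hG : ContDiffOn ℝ 2 (fun p : ℝ × ℝ => G p.1 p.2) {p : ℝ × ℝ | p.2 < p.1}) :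
    ContDiffOn ℝ 1 (fun p : ℝ × ℝ => p01 G p.1 p.2) {p : ℝ × ℝ | p.2 < p.1} := by
  have h := hG.fderiv_of_isOpen (m := 1) isOpen_snd_lt_fst (by norm_num)
  refine (h.clm_apply (contDiffOn_const (c := ((0 : ℝ), (1 : ℝ))))).congr fun p hp => ?_
  exact (hasDerivAt_p01_fderiv
    (differentiableAt_of_contDiffOn_one (hG.of_le (by norm_num)) hp)).deriv

theorem continuousOn_p10
    (hG : ContDiffOn ℝ 1 (fun p : ℝ × ℝ => G p.1 p.2) {p : ℝ × ℝ | p.2 < p.1}) :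
    ContinuousOn (fun p : ℝ × ℝ => p10 G p.1 p.2) {p : ℝ × ℝ | p.2 < p.1} := by
  have h := hG.continuousOn_fderiv_of_isOpen isOpen_snd_lt_fst le_rfl
  refine (h.clm_apply (continuousOn_const (c := ((1 : ℝ), (0 : ℝ))))).congr fun p hp => ?_
  exact (hasDerivAt_p10_fderiv (differentiableAt_of_contDiffOn_one hG hp)).deriv

end Partial

namespace SmoothVar

variable {F : ℝ → ℝ → ℝ} {d : ℝ}

theorem contDiffOn_one (hF : SmoothVar F d) :
    ContDiffOn ℝ 1 (fun p : ℝ × ℝ => F p.1 p.2) {p : ℝ × ℝ | p.2 < p.1} :=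
  hF.2.1.of_le (by norm_num)

theorem continuousOn_right (hF : SmoothVar F d) (t : ℝ) :
    ContinuousOn (fun r => F t r) (Set.Iic t) :=
  hF.1.comp (f := fun r => (t, r)) (by fun_prop) fun _ hr => hr

theorem continuousOn_p01_right (hF : SmoothVar F d) (t : ℝ) :
    ContinuousOn (fun r => p01 F t r) (Set.Iio t) :=
  (contDiffOn_p01 hF.2.1).continuousOn.comp (f := fun r => (t, r)) (by fun_prop) fun _ hr => hr

theorem exists_p01_neg (hF : SmoothVar F d) (hd : 0 < d) {K : Set ℝ} (hK : IsCompact K) :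
    ∃ η > 0, ∀ t ∈ K, ∀ r, r < t → t - r < η → p01 F t r < 0 := by
  obtain ⟨η, hη, h⟩ := hF.2.2.2.1 K hK d hd
  refine ⟨η, hη, fun t ht r hrt hr => ?_⟩
  have h1 := (abs_lt.1 (h (t - r) (by linarith) hr t ht)).2
  simp only [sub_sub_cancel] at h1
  by_contra! hneg
  have : 0 ≤ (t - r) * p01 F t r / F t r :=
    div_nonneg (mul_nonneg (by linarith) hneg) (hF.2.2.1 t r hrt).le
  linarith

theorem exists_p11_pos (hF : SmoothVar F d) (hd : d ∈ Set.Ioo (0 : ℝ) 1) {K : Set ℝ}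
    (hK : IsCompact K) :
    ∃ η > 0, ∀ t ∈ K, ∀ r, r < t → t - r < η → 0 < p11 F t r := by
  have hdd : 0 < d * (1 - d) := mul_pos hd.1 (by linarith [hd.2])
  obtain ⟨η, hη, h⟩ := hF.2.2.2.2.2.1 K hK _ hdd
  refine ⟨η, hη, fun t ht r hrt hr => ?_⟩
  have h1 := (abs_lt.1 (h (t - r) (by linarith) hr t ht)).1
  simp only [sub_sub_cancel] at h1
  by_contra! hneg
  have : (t - r) ^ 2 * p11 F t r / F t r ≤ 0 :=
    div_nonpos_of_nonpos_of_nonneg (mul_nonpos_of_nonneg_of_nonpos (sq_nonneg _) hneg)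
      (hF.2.2.1 t r hrt).le
  linarith

theorem diag_eq_zero (hF : SmoothVar F d) (hd : 0 < d) (t : ℝ) : F t t = 0 := by
  obtain ⟨η, hη, h⟩ := hF.2.2.2.1 {t} isCompact_singleton (d / 2) (by positivity)
  have hmono : MonotoneOn (fun u => u ^ (-(d / 2)) * F t (t - u)) (Set.Ioo 0 η) := by
    refine monotoneOn_rpow_neg_mul (g' := fun u => -p01 F t (t - u)) (fun u hu => ?_)
      (fun u hu => ?_)
    · have h1 := (hasDerivAt_p01 hF.contDiffOn_one (t := t) (r := t - u) (by linarith [hu.1]))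
      simpa using h1.comp_const_sub t u
    · have hpos := hF.2.2.1 t (t - u) (by linarith [hu.1])
      have h1 := (abs_lt.1 (h u hu.1 hu.2 t rfl)).2
      have h2 : u * p01 F t (t - u) / F t (t - u) < -(d / 2) := by linarith
      rw [div_lt_iff₀ hpos] at h2
      linarith
  set C := (η / 2) ^ (-(d / 2)) * F t (t - η / 2)
  have hle : ∀ᶠ u in nhdsWithin (0 : ℝ) (Set.Ioi 0), F t (t - u) ≤ u ^ (d / 2) * C := by
    filter_upwards [Ioo_mem_nhdsGT (half_pos hη)] with u hu
    have h1 := hmono (a := u) (b := η / 2) ⟨hu.1, by linarith [hu.2]⟩ ⟨by linarith, by linarith⟩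
      hu.2.le
    have h2 := mul_le_mul_of_nonneg_left h1 (Real.rpow_nonneg hu.1.le (d / 2))
    have h3 : u ^ (d / 2) * u ^ (-(d / 2)) = 1 := by
      rw [← Real.rpow_add hu.1]; simp
    simpa only [← mul_assoc, h3, one_mul, C] using h2
  have hlim : Tendsto (fun u => u ^ (d / 2) * C) (nhdsWithin (0 : ℝ) (Set.Ioi 0)) (nhds 0) := by
    have h1 := (Real.continuousAt_rpow_const 0 (d / 2) (Or.inr (by positivity))).tendsto
    rw [Real.zero_rpow (by positivity)] at h1
    simpa using (h1.mono_left nhdsWithin_le_nhds).mul_const C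
  have hF0 : Tendsto (fun u => F t (t - u)) (nhdsWithin (0 : ℝ) (Set.Ioi 0)) (nhds (F t t)) := by
    refine (hF.continuousOn_right t t Set.self_mem_Iic).tendsto.comp
      (tendsto_nhdsWithin_iff.2 ⟨?_, ?_⟩)
    · have : Tendsto (fun u : ℝ => t - u) (nhds 0) (nhds (t - 0)) :=
        (continuous_const.sub continuous_id).tendsto 0
      rw [sub_zero] at this
      exact this.mono_left nhdsWithin_le_nhds
    · filter_upwards [self_mem_nhdsWithin] with u hu
      simpa using (Set.mem_Ioi.1 hu).le
  refine le_antisymm (le_of_tendsto_of_tendsto hF0 hlim hle) (ge_of_tendsto hF0 ?_)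
  filter_upwards [self_mem_nhdsWithin] with u hu
  exact (hF.2.2.1 t (t - u) (by simpa using hu)).le

theorem tendsto_div_zero (hF : SmoothVar F d) (hd : d < 1) (s : ℝ) :
    Tendsto (fun h => h / F (s + h) s) (nhdsWithin (0 : ℝ) (Set.Ioi 0)) (nhds 0) := by
  set c := (1 + d) / 2 with hc
  obtain ⟨η, hη, h⟩ := hF.2.2.2.2.1 {s} isCompact_singleton (c - d) (by linarith)
  have hmono : MonotoneOn (fun u => u ^ (-c) * -F (s + u) s) (Set.Ioo 0 η) := by
    refine monotoneOn_rpow_neg_mul (g' := fun u => -p10 F (s + u) s) (fun u hu => ?_)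
      (fun u hu => ?_)
    · have h1 := (hasDerivAt_p10 hF.contDiffOn_one (t := s + u) (r := s) (by linarith [hu.1]))
      exact (h1.comp_const_add s u).neg
    · have hpos := hF.2.2.1 (s + u) s (by linarith [hu.1])
      have h1 := (abs_lt.1 (h u hu.1 hu.2 s rfl)).2
      have h2 : u * p10 F (s + u) s / F (s + u) s < c := by linarith
      rw [div_lt_iff₀ hpos] at h2
      linarith
  set C := (η / 2) ^ (-c) * F (s + η / 2) s with hC
  have hCpos : 0 < C :=
    mul_pos (Real.rpow_pos_of_pos (half_pos hη) _) (hF.2.2.1 _ _ (by linarith))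
  have hlim : Tendsto (fun u => u ^ (1 - c) / C) (nhdsWithin (0 : ℝ) (Set.Ioi 0)) (nhds 0) := by
    have h1 := (Real.continuousAt_rpow_const 0 (1 - c) (Or.inr (by linarith))).tendsto
    rw [Real.zero_rpow (by linarith)] at h1
    simpa using (h1.mono_left nhdsWithin_le_nhds).div_const C
  refine tendsto_of_tendsto_of_tendsto_of_le_of_le' tendsto_const_nhds hlim ?_ ?_
  · filter_upwards [self_mem_nhdsWithin] with u hu
    have hu' : 0 < u := hu
    exact (div_pos hu' (hF.2.2.1 _ _ (by linarith))).le
  · filter_upwards [Ioo_mem_nhdsGT (half_pos hη)] with u hu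
    have h1 := hmono (a := u) (b := η / 2) ⟨hu.1, by linarith [hu.2]⟩ ⟨by linarith, by linarith⟩
      hu.2.le
    have h2 : C ≤ u ^ (-c) * F (s + u) s := by
      simp only [mul_neg, neg_le_neg_iff] at h1
      exact h1
    have h3 : u ^ (1 - c) = u * u ^ (-c) := by
      rw [mul_comm, ← Real.rpow_add_one hu.1.ne']; ring_nf
    rw [div_le_div_iff₀ (hF.2.2.1 _ _ (by linarith [hu.1])) hCpos, h3, mul_assoc]
    exact mul_le_mul_of_nonneg_left h2 hu.1.le

theorem intervalIntegrable_p01 (hF : SmoothVar F d) (hd : 0 < d) {a b t : ℝ} (ha : a ≤ t)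
    (hb : b ≤ t) : IntervalIntegrable (fun r => p01 F t r) volume a b := by
  obtain ⟨η, hη, h⟩ := hF.exists_p01_neg hd (isCompact_singleton (x := t))
  have key : ∀ a ≤ t, IntervalIntegrable (fun r => p01 F t r) volume a t := by
    intro a ha
    rcases ha.eq_or_lt with rfl | hat
    · exact IntervalIntegrable.refl
    have h1 : IntervalIntegrable (fun r => p01 F t r) volume a (t - η / 2) := by
      refine (hF.continuousOn_p01_right t).mono (fun r hr => ?_) |>.intervalIntegrable
      exact (hr.2.trans_lt (max_lt hat (by linarith)) : r < t)
    have h2 : IntervalIntegrable (fun r => p01 F t r) volume (t - η / 2) t := by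
      rw [← neg_neg (fun r => p01 F t r)]
      refine IntervalIntegrable.neg (intervalIntegrable_deriv_of_nonneg (g := fun r => -F t r) ?_ ?_ ?_)
      · exact (hF.continuousOn_right t).neg.mono (fun r hr => by
          rw [Set.uIcc_of_le (by linarith)] at hr; exact hr.2)
      · intro r hr
        rw [min_eq_left (by linarith), max_eq_right (by linarith)] at hr
        exact (hasDerivAt_p01 hF.contDiffOn_one hr.2).neg
      · intro r hr
        rw [min_eq_left (by linarith), max_eq_right (by linarith)] at hr
        have := h t rfl r hr.2 (by linarith [hr.1])
        simp only [Pi.neg_apply]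
        linarith
    exact h1.trans h2
  exact (key a ha).trans (key b hb).symm

theorem integral_p01 (hF : SmoothVar F d) (hd : 0 < d) {a b t : ℝ} (hab : a ≤ b) (hb : b ≤ t) :
    ∫ r in a..b, p01 F t r = F t b - F t a :=
  integral_eq_sub_of_hasDerivAt_of_le hab
    ((hF.continuousOn_right t).mono fun _ hr => hr.2.trans hb)
    (fun _ hr => hasDerivAt_p01 hF.contDiffOn_one (hr.2.trans_le hb))
    (hF.intervalIntegrable_p01 hd (hab.trans hb) hb)

end SmoothVar

theorem intervalIntegrable_mul_of_abs_le {k x : ℝ → ℝ} {a b C : ℝ}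
    (hk : IntervalIntegrable k volume a b) (hx : Measurable x)
    (hC : ∀ r ∈ Set.uIcc a b, |x r| ≤ C) :
    IntervalIntegrable (fun r => k r * x r) volume a b := by
  rw [intervalIntegrable_iff] at hk ⊢
  refine Integrable.mul_bdd (c := C) hk hx.aestronglyMeasurable ?_
  filter_upwards [ae_restrict_mem measurableSet_uIoc] with r hr
  exact hC r (Set.uIoc_subset_uIcc hr)

theorem abs_integral_mul_sub_le {k x : ℝ → ℝ} {a b c ε : ℝ} (hab : a ≤ b)
    (hk : IntervalIntegrable k volume a b)
    (hkx : IntervalIntegrable (fun r => k r * x r) volume a b)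
    (hk0 : ∀ r ∈ Set.Ioo a b, 0 ≤ k r) (hx : ∀ r ∈ Set.Ioo a b, |x r - c| ≤ ε) :
    |(∫ r in a..b, k r * x r) - c * ∫ r in a..b, k r| ≤ ε * ∫ r in a..b, k r := by
  rw [← intervalIntegral.integral_const_mul, ← intervalIntegral.integral_const_mul,
    ← intervalIntegral.integral_sub hkx (hk.const_mul c), ← Real.norm_eq_abs]
  refine intervalIntegral.norm_integral_le_of_norm_le hab ?_ (hk.const_mul ε)
  filter_upwards [Measure.ae_ne volume b] with r hrb hr
  have hr' : r ∈ Set.Ioo a b := ⟨hr.1, lt_of_le_of_ne hr.2 hrb⟩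
  rw [Real.norm_eq_abs, mul_comm c, ← mul_sub, abs_mul, abs_of_nonneg (hk0 r hr'), mul_comm]
  exact mul_le_mul_of_nonneg_right (hx r hr') (hk0 r hr')

namespace SmoothVar

variable {F : ℝ → ℝ → ℝ} {d : ℝ} {x : ℝ → ℝ}

theorem tendsto_integral_recent (hF : SmoothVar F d) (hd : 0 < d) (hx : Measurable x)
    (hbdd : ∀ a b, ∃ C, ∀ r ∈ Set.Icc a b, |x r| ≤ C) {s : ℝ}
    (hxs : Tendsto x (nhdsWithin s (Set.Ici s)) (nhds (x s))) :
    Tendsto (fun h => (-∫ r in s..(s + h), p01 F (s + h) r * x r) / F (s + h) s)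
      (nhdsWithin 0 (Set.Ioi 0)) (nhds (x s)) := by
  obtain ⟨η, hη, hneg⟩ := hF.exists_p01_neg hd (isCompact_Icc (a := s) (b := s + 1))
  rw [Metric.tendsto_nhds]
  intro ε hε
  obtain ⟨u, hu, hxu⟩ := mem_nhdsGE_iff_exists_Ico_subset.1
    (hxs.eventually (Metric.closedBall_mem_nhds (x s) (half_pos hε)))
  have hu' : 0 < u - s := sub_pos.2 hu
  filter_upwards [Ioo_mem_nhdsGT (lt_min hη (lt_min one_pos hu'))] with h hh
  obtain ⟨hh0, hh⟩ := hh
  rw [lt_min_iff, lt_min_iff] at hh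
  have hpos := hF.2.2.1 (s + h) s (by linarith)
  have hint := (hF.intervalIntegrable_p01 hd (a := s) (b := s + h) (t := s + h)
    (by linarith) le_rfl).neg
  obtain ⟨C, hC⟩ := hbdd s (s + h)
  have key := abs_integral_mul_sub_le (x := x) (c := x s) (ε := ε / 2) (by linarith) hint
    (intervalIntegrable_mul_of_abs_le hint hx
      (by rwa [Set.uIcc_of_le (by linarith : s ≤ s + h)]))
    (fun r hr => by
      have := hneg (s + h) ⟨by linarith, by linarith⟩ r hr.2 (by linarith [hr.1])
      simp only [Pi.neg_apply]; linarith)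
    (fun r hr => hxu ⟨hr.1.le, by linarith [hr.2]⟩)
  simp only [Pi.neg_apply, neg_mul, intervalIntegral.integral_neg] at key
  rw [hF.integral_p01 hd (by linarith) le_rfl, hF.diag_eq_zero hd, zero_sub, neg_neg] at key
  rw [Real.dist_eq, div_sub' hpos.ne', abs_div, abs_of_pos hpos, div_lt_iff₀ hpos]
  rw [mul_comm (F (s + h) s)]
  nlinarith

theorem tendsto_integral_distant (hF : SmoothVar F d) (hd : d < 1)
    (hbdd : ∀ a b, ∃ C, ∀ r ∈ Set.Icc a b, |x r| ≤ C) {a s : ℝ} (ha : 0 ≤ a) (has : a < s) :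
    Tendsto (fun h => (∫ r in (0 : ℝ)..a, (p01 F (s + h) r - p01 F s r) * x r) / F (s + h) s)
      (nhdsWithin 0 (Set.Ioi 0)) (nhds 0) := by
  obtain ⟨C, hC⟩ := ((isCompact_Icc (a := s) (b := s + 1)).prod
    (isCompact_Icc (a := 0) (b := a))).exists_bound_of_continuousOn
    ((continuousOn_p10 (contDiffOn_p01 hF.2.1)).mono
      fun p hp => hp.2.2.trans_lt (has.trans_le hp.1.1))
  obtain ⟨B, hB⟩ := hbdd 0 a
  have hlim := (hF.tendsto_div_zero hd s).const_mul (C * B * a)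
  rw [mul_zero] at hlim
  refine squeeze_zero_norm' ?_ hlim
  filter_upwards [Ioo_mem_nhdsGT (one_pos (α := ℝ))] with h hh
  have hpos := hF.2.2.1 (s + h) s (by linarith [hh.1])
  rw [norm_div, Real.norm_of_nonneg hpos.le, ← mul_div_assoc]
  gcongr
  have h1 := intervalIntegral.norm_integral_le_of_norm_le_const (a := 0) (b := a)
    (f := fun r => (p01 F (s + h) r - p01 F s r) * x r) (C := C * h * B) fun r hr => by
      rw [Set.uIoc_of_le ha] at hr
      have hr' : r ∈ Set.Icc 0 a := ⟨hr.1.le, hr.2⟩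
      have h2 := (convex_Icc s (s + 1)).norm_image_sub_le_of_norm_hasDerivWithin_le
        (f := fun t => p01 F t r) (f' := fun t => p11 F t r) (C := C)
        (fun t ht => (hasDerivAt_p10 (contDiffOn_p01 hF.2.1)
          (hr.2.trans_lt (has.trans_le ht.1))).hasDerivWithinAt)
        (fun t ht => hC (t, r) ⟨ht, hr'⟩)
        (x := s) (y := s + h) ⟨le_rfl, by linarith⟩ ⟨by linarith [hh.1], by linarith [hh.2]⟩
      rw [add_sub_cancel_left, Real.norm_of_nonneg hh.1.le] at h2
      rw [norm_mul]
      exact mul_le_mul h2 (hB r hr') (norm_nonneg _) ((norm_nonneg _).trans h2)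
  rw [sub_zero, abs_of_nonneg ha] at h1
  linarith

theorem tendsto_increment_div_zero (hF : SmoothVar F d) (hd : d < 1) {a s : ℝ} (has : a < s) :
    Tendsto (fun h => (F (s + h) a - F s a) / F (s + h) s)
      (nhdsWithin 0 (Set.Ioi 0)) (nhds 0) := by
  have h1 := (hasDerivAt_p10 hF.contDiffOn_one has).tendsto_slope_zero.mono_left
    (nhdsWithin_mono _ fun h (hh : 0 < h) => hh.ne')
  have h2 := h1.mul (hF.tendsto_div_zero hd s)
  rw [mul_zero] at h2
  refine h2.congr' ?_
  filter_upwards [self_mem_nhdsWithin] with h (hh : 0 < h)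
  rw [smul_eq_mul]
  field_simp

theorem tendsto_integral_past (hF : SmoothVar F d) (hd : d ∈ Set.Ioo (0 : ℝ) 1)
    (hx : Measurable x) (hbdd : ∀ a b, ∃ C, ∀ r ∈ Set.Icc a b, |x r| ≤ C) {s y : ℝ} (hs : 0 < s)
    (hxs : Tendsto x (nhdsWithin s (Set.Iio s)) (nhds y)) :
    Tendsto (fun h => (∫ r in (0 : ℝ)..s, (p01 F (s + h) r - p01 F s r) * x r) / F (s + h) s)
      (nhdsWithin 0 (Set.Ioi 0)) (nhds y) := by
  obtain ⟨η, hη, hp11⟩ := hF.exists_p11_pos hd (isCompact_Icc (a := s) (b := s + 1))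
  have hint : ∀ h ≥ 0, ∀ a ≤ s, ∀ b ≤ s,
      IntervalIntegrable (fun r => p01 F (s + h) r - p01 F s r) volume a b := fun h hh a ha b hb =>
    (hF.intervalIntegrable_p01 hd.1 (by linarith) (by linarith)).sub
      (hF.intervalIntegrable_p01 hd.1 ha hb)
  have hintx : ∀ h ≥ 0, ∀ a ≤ s, ∀ b ≤ s,
      IntervalIntegrable (fun r => (p01 F (s + h) r - p01 F s r) * x r) volume a b := by
    intro h hh a ha b hb
    obtain ⟨C, hC⟩ := hbdd (min a b) (max a b)
    exact intervalIntegrable_mul_of_abs_le (hint h hh a ha b hb) hx hC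
  rw [Metric.tendsto_nhds]
  intro ε hε
  obtain ⟨l, hl, hxl⟩ := mem_nhdsLT_iff_exists_Ioo_subset.1
    (hxs.eventually (Metric.closedBall_mem_nhds y (half_pos hε)))
  obtain ⟨a, hal, has⟩ := exists_between (max_lt hs (max_lt hl (by linarith : s - η / 2 < s)))
  rw [max_lt_iff, max_lt_iff] at hal
  have hQ := (hF.tendsto_integral_distant hd.2 hbdd hal.1.le has).abs
  have hP := (hF.tendsto_increment_div_zero hd.2 has).abs
  have hlim := (hQ.add ((hP.const_add 1).const_mul (ε / 2))).add (hP.const_mul |y|)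
  have hev := hlim.eventually_lt_const (u := ε) (by simpa using hε)
  filter_upwards [Ioo_mem_nhdsGT (lt_min (half_pos hη) one_pos), hev] with h hh hlt
  obtain ⟨hh0, hh⟩ := hh
  rw [lt_min_iff] at hh
  have hpos := hF.2.2.1 (s + h) s (by linarith)
  have key := abs_integral_mul_sub_le (x := x) (c := y) (ε := ε / 2) has.le
    (hint h hh0.le a has.le s le_rfl) (hintx h hh0.le a has.le s le_rfl)
    (fun r hr => by
      refine sub_nonneg.2 (monotoneOn_of_deriv_nonneg (f := fun t => p01 F t r)
        (convex_Icc s (s + h)) (fun t ht => ?_) (fun t ht => ?_) (fun t ht => ?_)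
        (Set.left_mem_Icc.2 (by linarith)) (Set.right_mem_Icc.2 (by linarith)) (by linarith))
      · exact (hasDerivAt_p10 (contDiffOn_p01 hF.2.1)
          (hr.2.trans_le ht.1)).continuousAt.continuousWithinAt
      · have ht := interior_subset ht
        exact (hasDerivAt_p10 (contDiffOn_p01 hF.2.1)
          (hr.2.trans_le ht.1)).differentiableAt.differentiableWithinAt
      · have ht := interior_subset ht
        exact (hp11 t ⟨ht.1, by linarith [ht.2]⟩ r (hr.2.trans_le ht.1)
          (by linarith [ht.2, hr.1])).le)
    (fun r hr => hxl ⟨hal.2.1.trans hr.1, hr.2⟩)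
  rw [intervalIntegral.integral_sub (hF.intervalIntegrable_p01 hd.1 (by linarith) (by linarith))
    (hF.intervalIntegrable_p01 hd.1 has.le le_rfl), hF.integral_p01 hd.1 has.le (by linarith),
    hF.integral_p01 hd.1 has.le le_rfl, hF.diag_eq_zero hd.1] at key
  rw [← intervalIntegral.integral_add_adjacent_intervals (hintx h hh0.le 0 hs.le a has.le)
    (hintx h hh0.le a has.le s le_rfl), Real.dist_eq]
  refine lt_of_le_of_lt ?_ hlt
  set A := ∫ r in (0 : ℝ)..a, (p01 F (s + h) r - p01 F s r) * x r
  set B := ∫ r in a..s, (p01 F (s + h) r - p01 F s r) * x r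
  set f := F (s + h) s
  set P := F (s + h) a - F s a with hPdef
  rw [show f - F (s + h) a - (0 - F s a) = f - P by rw [hPdef]; ring] at key
  have hsplit : (A + B) / f - y = A / f + (B - y * (f - P)) / f + -(y * (P / f)) := by
    field_simp; ring
  have hmid : |(B - y * (f - P)) / f| ≤ ε / 2 * (1 + |P / f|) := by
    rw [abs_div, abs_of_pos hpos, div_le_iff₀ hpos, abs_div, abs_of_pos hpos, mul_assoc, add_mul,
      one_mul, div_mul_cancel₀ _ hpos.ne']
    refine key.trans (mul_le_mul_of_nonneg_left ?_ (half_pos hε).le)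
    linarith [neg_abs_le P]
  rw [hsplit]
  refine (abs_add_three _ _ _).trans ?_
  rw [abs_neg, abs_mul y]
  gcongr

theorem tendsto_increment_div (hF : SmoothVar F d) (hd : d ∈ Set.Ioo (0 : ℝ) 1) {xm m : ℝ → ℝ}
    (hx : ∀ s, Tendsto x (nhdsWithin s (Set.Ici s)) (nhds (x s)))
    (hxm : ∀ s, Tendsto x (nhdsWithin s (Set.Iio s)) (nhds (xm s))) (hxm0 : xm 0 = 0)
    (hm : ∀ t, m t = -∫ r in (0 : ℝ)..t, p01 F t r * x r) {s : ℝ} (hs : 0 ≤ s) :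
    Tendsto (fun h => (m (s + h) - m s) / F (s + h) s)
      (nhdsWithin 0 (Set.Ioi 0)) (nhds (x s - xm s)) := by
  have hmeas := measurable_of_tendsto_nhdsGE hx
  have hbdd : ∀ a b, ∃ C, ∀ r ∈ Set.Icc a b, |x r| ≤ C := fun a b =>
    exists_abs_le_of_cadlag hx hxm isCompact_Icc
  have hint : ∀ a b t, a ≤ t → b ≤ t →
      IntervalIntegrable (fun r => p01 F t r * x r) volume a b := by
    intro a b t ha hb
    obtain ⟨C, hC⟩ := hbdd (min a b) (max a b)
    exact intervalIntegrable_mul_of_abs_le (hF.intervalIntegrable_p01 hd.1 ha hb) hmeas hC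
  have hpast : Tendsto
      (fun h => (∫ r in (0 : ℝ)..s, (p01 F (s + h) r - p01 F s r) * x r) / F (s + h) s)
      (nhdsWithin 0 (Set.Ioi 0)) (nhds (xm s)) := by
    rcases hs.eq_or_lt with rfl | hs
    · simp [hxm0]
    · exact hF.tendsto_integral_past hd hmeas hbdd hs (hxm s)
  refine ((hF.tendsto_integral_recent hd.1 hmeas hbdd (hx s)).sub hpast).congr' ?_
  filter_upwards [self_mem_nhdsWithin] with h (hh : 0 < h)
  rw [hm, hm, ← intervalIntegral.integral_add_adjacent_intervals
    (hint 0 s (s + h) (by linarith) (by linarith)) (hint s (s + h) (s + h) (by linarith) le_rfl)]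
  simp only [sub_mul]
  rw [intervalIntegral.integral_sub (hint 0 s (s + h) (by linarith) (by linarith))
    (hint 0 s s hs le_rfl)]
  ring

end SmoothVar

/-- Theorem 1: `F ∈ SR²_d(0+)`, `X` a semimartingale with càdlàg
paths, left limits `Xm`, and `X(0) = X(0−) = 0` a.s.  The Volterra process
`M(t) = ∫₀ᵗ F(t,r) dX(r)` is represented pathwise, via the integration-by-parts
Lemma 1, as `M(t) = −∫₀ᵗ F^{(0,1)}(t,r) X(r) dr`.  Then a.s., for every
`s ∈ [0,1]`, `lim_{h↓0} (M(s+h) − M(s))/F(s+h,s) = Δ_X(s) = X(s) − X(s−)`. -/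
theorem theorem1_jump_behavior
    {Ω : Type*} [MeasureSpace Ω] [IsProbabilityMeasure (ℙ : Measure Ω)]
    (d : ℝ) (hd : d ∈ Set.Ioo (0:ℝ) 1)
    (F : ℝ → ℝ → ℝ) (hF : SmoothVar F d)
    (X Xm M : ℝ → Ω → ℝ)
    (hXrc : ∀ᵐ ω ∂(ℙ : Measure Ω), ∀ s : ℝ,
      Tendsto (fun u => X u ω) (nhdsWithin s (Set.Ici s)) (nhds (X s ω)))
    (hXll : ∀ᵐ ω ∂(ℙ : Measure Ω), ∀ s : ℝ,
      Tendsto (fun u => X u ω) (nhdsWithin s (Set.Iio s)) (nhds (Xm s ω)))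
    (hX0 : ∀ᵐ ω ∂(ℙ : Measure Ω), X 0 ω = 0 ∧ Xm 0 ω = 0)
    -- pathwise representation `M(t) = ∫₀ᵗ F(t,r) dX(r) = −∫₀ᵗ F^{(0,1)}(t,r) X(r) dr`
    -- (Lemma 1 of the paper):
    (hM : ∀ᵐ ω ∂(ℙ : Measure Ω), ∀ t : ℝ,
      M t ω = -∫ r in (0:ℝ)..t, p01 F t r * X r ω) :
    ∀ᵐ ω ∂(ℙ : Measure Ω), ∀ s ∈ Set.Icc (0:ℝ) 1,
      Tendsto (fun h : ℝ => (M (s + h) ω - M s ω) / F (s + h) s)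
        (nhdsWithin 0 (Set.Ioi 0)) (nhds (X s ω - Xm s ω)) := by
  filter_upwards [hXrc, hXll, hX0, hM] with ω hrc hll h0 hm s hs
  exact hF.tendsto_increment_div hd (x := fun u => X u ω) (xm := fun u => Xm u ω)
    (m := fun t => M t ω) hrc hll h0.2 hm hs.1
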